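/- Let A be an abelian category and let U and V be classes of objects of A, each closed under isomorphisms and direct summands. Then the following are equivalent: (1) (U, V) is a complete hereditary cotorsion pair in A; (2) (Mon(U), Epi(V)) is a weak factorization system on A such that Mon(U) satisfies the left cancellation property; (3) (Mon(U), Epi(V)) is a weak factorization system on A such that Epi(V) satisfies the right cancellation property. -/

import Mathlib

open CategoryTheory CategoryTheory.Limits

universe v u

section GeneralDefs

variable {C : Type u} [Category.{v} C]

/-- `HasLift l r` means `l` has the left lifting property with respect to `r`
(equivalently `r` has the right lifting property with respect to `l`): written `l □ r`. -/
def HasLift {X Y Z W : C} (l : X ⟶ Y) (r : Z ⟶ W) : Prop :=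
  ∀ (f : X ⟶ Z) (g : Y ⟶ W), l ≫ g = f ≫ r →
    ∃ t : Y ⟶ Z, l ≫ t = f ∧ t ≫ r = g

/-- `(L, R)` is a weak factorization system: `L = ^□R`, `R = L^□`, and every morphism
factors as a morphism in `L` followed by a morphism in `R`. -/
def IsWFS (L R : MorphismProperty C) : Prop :=
  (∀ {X Y : C} (f : X ⟶ Y), L f ↔ ∀ {Z W : C} (r : Z ⟶ W), R r → HasLift f r) ∧
  (∀ {X Y : C} (g : X ⟶ Y), R g ↔ ∀ {Z W : C} (l : Z ⟶ W), L l → HasLift l g) ∧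
  (∀ {X Y : C} (h : X ⟶ Y), ∃ (Z : C) (f : X ⟶ Z) (g : Z ⟶ Y), L f ∧ R g ∧ f ≫ g = h)

/-- `L` satisfies the left cancellation property: `β ∘ α ∈ L` and `β ∈ L` imply `α ∈ L`. -/
def LeftCancel (L : MorphismProperty C) : Prop :=
  ∀ {X Y Z : C} (α : X ⟶ Y) (β : Y ⟶ Z), L (α ≫ β) → L β → L α

/-- `R` satisfies the right cancellation property: `β ∘ α ∈ R` and `α ∈ R` imply `β ∈ R`. -/
def RightCancel (R : MorphismProperty C) : Prop :=
  ∀ {X Y Z : C} (α : X ⟶ Y) (β : Y ⟶ Z), R (α ≫ β) → R α → R β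

/-- The weak factorization systems `(L, Rt)` and `(Lt, R)` are compatible:
(CP1) `Lt ⊆ L`; (CP2) two-out-of-three for `Rt` among composable morphisms of `R`;
(CP3) if `l ∈ Lt`, `r ∈ R` and `r ∘ l ∈ Lt` then `r ∈ Rt`. -/
def CompatWFS (L Rt Lt R : MorphismProperty C) : Prop :=
  (∀ {X Y : C} (f : X ⟶ Y), Lt f → L f) ∧
  (∀ {X Y Z : C} (α : X ⟶ Y) (β : Y ⟶ Z), R α → R β →
    (Rt α → Rt β → Rt (α ≫ β)) ∧ (Rt α → Rt (α ≫ β) → Rt β) ∧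
    (Rt β → Rt (α ≫ β) → Rt α)) ∧
  (∀ {X Y Z : C} (l : X ⟶ Y) (r : Y ⟶ Z), Lt l → R r → Lt (l ≫ r) → Rt r)

end GeneralDefs

section AbelianDefs

variable {A : Type u} [Category.{v} A] [Abelian A]

/-- `0 → X → Y → Z → 0` is a short exact sequence. -/
def IsSES {X Y Z : A} (i : X ⟶ Y) (p : Y ⟶ Z) : Prop :=
  ∃ w : i ≫ p = 0, (ShortComplex.mk i p w).ShortExact

/-- `Mon(U)`: monomorphisms with cokernel in `U`. -/
def MonCl (U : A → Prop) : MorphismProperty A :=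
  fun _ _ f => Mono f ∧ U (cokernel f)

/-- `Epi(V)`: epimorphisms with kernel in `V`. -/
def EpiCl (V : A → Prop) : MorphismProperty A :=
  fun _ _ g => Epi g ∧ V (kernel g)

/-- `(U, V)` is a complete cotorsion pair: both classes are closed under isomorphisms and
direct summands, every short exact sequence `0 → V' → E → U' → 0` with `U' ∈ U`, `V' ∈ V`
splits (i.e. `Ext^1(U, V) = 0`), and every object admits the two approximation sequences. -/
structure IsCompleteCotorsionPair (U V : A → Prop) : Prop where
  isoU : ∀ {X Y : A}, (X ≅ Y) → U X → U Y
  isoV : ∀ {X Y : A}, (X ≅ Y) → V X → V Y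
  summandU : ∀ {X Z : A} (i : X ⟶ Z) (r : Z ⟶ X), i ≫ r = 𝟙 X → U Z → U X
  summandV : ∀ {X Z : A} (i : X ⟶ Z) (r : Z ⟶ X), i ≫ r = 𝟙 X → V Z → V X
  ext_zero : ∀ {V' E U' : A} (i : V' ⟶ E) (p : E ⟶ U'),
    V V' → U U' → IsSES i p → ∃ s : E ⟶ V', i ≫ s = 𝟙 V'
  complete_left : ∀ C : A, ∃ (V' U' : A) (i : V' ⟶ U') (p : U' ⟶ C),
    U U' ∧ V V' ∧ IsSES i p
  complete_right : ∀ C : A, ∃ (V' U' : A) (i : C ⟶ V') (p : V' ⟶ U'),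
    U U' ∧ V V' ∧ IsSES i p

end AbelianDefs

variable {A : Type u} [Category.{v} A] [Abelian A]

section

open scoped ZeroObject
namespace IsSES

variable {X Y Z : A} {i : X ⟶ Y} {p : Y ⟶ Z}

lemma zero (h : IsSES i p) : i ≫ p = 0 := h.1

lemma mono (h : IsSES i p) : Mono i := h.2.mono_f

lemma epi (h : IsSES i p) : Epi p := h.2.epi_g

lemma exists_lift (h : IsSES i p) {T : A} (k : T ⟶ Y) (hk : k ≫ p = 0) :
    ∃ l : T ⟶ X, l ≫ i = k := by
  obtain ⟨w, h⟩ := h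
  have := h.mono_f
  exact h.exact.lift' k hk

lemma exists_desc (h : IsSES i p) {T : A} (k : Y ⟶ T) (hk : i ≫ k = 0) :
    ∃ l : Z ⟶ T, p ≫ l = k := by
  obtain ⟨w, h⟩ := h
  have := h.epi_g
  exact h.exact.desc' k hk

lemma of_exists_lift [Mono i] [Epi p] (w : i ≫ p = 0)
    (h : ∀ {T : A} (k : T ⟶ Y), k ≫ p = 0 → ∃ l : T ⟶ X, l ≫ i = k) : IsSES i p :=
  ⟨w, { exact := ShortComplex.exact_of_f_is_kernel _ (KernelFork.IsLimit.ofι' i w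
          fun k hk => ⟨(h k hk).choose, (h k hk).choose_spec⟩) }⟩

lemma of_exists_desc [Mono i] [Epi p] (w : i ≫ p = 0)
    (h : ∀ {T : A} (k : Y ⟶ T), i ≫ k = 0 → ∃ l : Z ⟶ T, p ≫ l = k) : IsSES i p :=
  ⟨w, { exact := ShortComplex.exact_of_g_is_cokernel _ (CokernelCofork.IsColimit.ofπ' p w
          fun k hk => ⟨(h k hk).choose, (h k hk).choose_spec⟩) }⟩

lemma cokernel (f : X ⟶ Y) [Mono f] : IsSES f (cokernel.π f) :=
  of_exists_desc (by simp) fun k hk => ⟨cokernel.desc f k hk, by simp⟩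

lemma kernel (f : X ⟶ Y) [Epi f] : IsSES (kernel.ι f) f :=
  of_exists_lift (by simp) fun k hk => ⟨kernel.lift f k hk, by simp⟩

lemma nonempty_cokernel_iso (h : IsSES i p) : Nonempty (Limits.cokernel i ≅ Z) := by
  obtain ⟨w, h⟩ := h
  exact ⟨(cokernelIsCokernel i).coconePointUniqueUpToIso h.gIsCokernel⟩

lemma nonempty_kernel_iso (h : IsSES i p) : Nonempty (Limits.kernel p ≅ X) := by
  obtain ⟨w, h⟩ := h
  exact ⟨(kernelIsKernel p).conePointUniqueUpToIso h.fIsKernel⟩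

lemma id_zero (X : A) : IsSES (𝟙 X) (0 : X ⟶ (0 : A)) :=
  have : Epi (0 : X ⟶ (0 : A)) := ⟨fun _ _ _ => (isZero_zero A).eq_of_src _ _⟩
  of_exists_lift (by simp) fun k _ => ⟨k, by simp⟩

lemma zero_id (X : A) : IsSES (0 : (0 : A) ⟶ X) (𝟙 X) :=
  have : Mono (0 : (0 : A) ⟶ X) := ⟨fun _ _ _ => (isZero_zero A).eq_of_tgt _ _⟩
  of_exists_desc (by simp) fun k _ => ⟨k, by simp⟩

lemma inl_snd (X Y : A) : IsSES (biprod.inl : X ⟶ X ⊞ Y) (biprod.snd : X ⊞ Y ⟶ Y) :=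
  of_exists_lift (by simp) fun k hk => ⟨k ≫ biprod.fst, by
    ext <;> simp [hk]⟩

/-- The pullback of a short exact sequence along a morphism to its third term. -/
lemma pullback (h : IsSES i p) {B : A} (g : B ⟶ Z) :
    IsSES (pullback.lift i 0 (by simp [h.zero]) : X ⟶ Limits.pullback p g)
      (pullback.snd p g) := by
  have := h.mono
  have := h.epi
  have : Mono (pullback.lift i 0 (by simp [h.zero]) : X ⟶ Limits.pullback p g) :=
    mono_of_mono_fac (pullback.lift_fst i 0 (by simp [h.zero]))
  refine of_exists_lift (pullback.lift_snd _ _ _) fun k hk => ?_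
  obtain ⟨l, hl⟩ := h.exists_lift (k ≫ pullback.fst p g) (by
    rw [Category.assoc, pullback.condition, reassoc_of% hk, zero_comp])
  exact ⟨l, by ext <;> simp [hl, hk, pullback.lift_fst, pullback.lift_snd]⟩

/-- The pushout of a short exact sequence along a morphism from its first term. -/
lemma pushout (h : IsSES i p) {B : A} (g : X ⟶ B) :
    IsSES (pushout.inr i g)
      (pushout.desc p 0 (by simp [h.zero]) : Limits.pushout i g ⟶ Z) := by
  have := h.mono
  have := h.epi
  have : Epi (pushout.desc p 0 (by simp [h.zero]) : Limits.pushout i g ⟶ Z) :=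
    epi_of_epi_fac (pushout.inl_desc p 0 (by simp [h.zero]))
  refine of_exists_desc (pushout.inr_desc _ _ _) fun k hk => ?_
  obtain ⟨l, hl⟩ := h.exists_desc (pushout.inl i g ≫ k) (by
    rw [pushout.condition_assoc, hk, comp_zero])
  exact ⟨l, by ext <;> simp [hl, hk, pushout.inl_desc_assoc, pushout.inr_desc_assoc]⟩

/-- The cokernels of `α`, `α ≫ β` and `β` form a short exact sequence if `β` is mono. -/
lemma exists_cokernel_comp {X Y Z P Q R : A} {α : X ⟶ Y} {β : Y ⟶ Z} {a : Y ⟶ P}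
    {b : Z ⟶ Q} {c : Z ⟶ R} (ha : IsSES α a) (hb : IsSES β b) (hc : IsSES (α ≫ β) c) :
    ∃ (u : P ⟶ R) (v : R ⟶ Q), IsSES u v ∧ a ≫ u = β ≫ c ∧ c ≫ v = b := by
  have := ha.epi
  have := hb.epi
  have := hc.epi
  have := hb.mono
  obtain ⟨u, hu⟩ := ha.exists_desc (β ≫ c) (by rw [← Category.assoc, hc.zero])
  obtain ⟨v, hv⟩ := hc.exists_desc b (by rw [Category.assoc, hb.zero, comp_zero])
  have : Epi v := epi_of_epi_fac hv
  have : Mono u := by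
    refine Preadditive.mono_of_cancel_zero u fun x hx => ?_
    obtain ⟨T, π, hπ, y, hy⟩ := surjective_up_to_refinements_of_epi a x
    obtain ⟨z, hz⟩ := hc.exists_lift (y ≫ β) (by
      rw [Category.assoc, ← hu, ← reassoc_of% hy, hx, comp_zero])
    rw [← cancel_epi π, hy, comp_zero]
    have : z ≫ α = y := by rw [← cancel_mono β, Category.assoc, hz]
    rw [← this, Category.assoc, ha.zero, comp_zero]
  refine ⟨u, v, of_exists_desc ?_ fun k hk => ?_, hu, hv⟩
  · rw [← cancel_epi a, reassoc_of% hu, hv, hb.zero, comp_zero]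
  · obtain ⟨w, hw⟩ := hb.exists_desc (c ≫ k) (by
      rw [← reassoc_of% hu, hk, comp_zero])
    exact ⟨w, by rw [← cancel_epi c, reassoc_of% hv, hw]⟩

/-- The kernels of `α`, `α ≫ β` and `β` form a short exact sequence if `α` is epi. -/
lemma exists_kernel_comp {X Y Z P Q R : A} {α : X ⟶ Y} {β : Y ⟶ Z} {a : P ⟶ X}
    {b : Q ⟶ Y} {c : R ⟶ X} (ha : IsSES a α) (hb : IsSES b β) (hc : IsSES c (α ≫ β)) :
    ∃ (u : P ⟶ R) (v : R ⟶ Q), IsSES u v ∧ u ≫ c = a ∧ v ≫ b = c ≫ α := by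
  have := ha.mono
  have := hb.mono
  have := hc.mono
  have := ha.epi
  obtain ⟨u, hu⟩ := hc.exists_lift a (by rw [reassoc_of% ha.zero, zero_comp])
  obtain ⟨v, hv⟩ := hb.exists_lift (c ≫ α) (by rw [Category.assoc, hc.zero])
  have : Mono u := mono_of_mono_fac hu
  have : Epi v := by
    refine (epi_iff_surjective_up_to_refinements v).2 fun T x => ?_
    obtain ⟨T', π, hπ, y, hy⟩ := surjective_up_to_refinements_of_epi α (x ≫ b)
    obtain ⟨z, hz⟩ := hc.exists_lift y (by
      rw [← reassoc_of% hy, hb.zero, comp_zero, comp_zero])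
    exact ⟨T', π, hπ, z, by
      rw [← cancel_mono b, Category.assoc, Category.assoc, hv, reassoc_of% hz, hy]⟩
  refine ⟨u, v, of_exists_lift ?_ fun k hk => ?_, hu, hv⟩
  · rw [← cancel_mono b, Category.assoc, hv, reassoc_of% hu, ha.zero, zero_comp]
  · obtain ⟨w, hw⟩ := ha.exists_lift (k ≫ c) (by
      rw [Category.assoc, ← hv, reassoc_of% hk, zero_comp])
    exact ⟨w, by rw [← cancel_mono c, Category.assoc, hu, hw]⟩

end IsSES

variable {U V : A → Prop}

lemma monCl_of_isSES (hU : ∀ {X Y : A}, (X ≅ Y) → U X → U Y) {X Y Z : A} {i : X ⟶ Y}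
    {p : Y ⟶ Z} (h : IsSES i p) (hZ : U Z) : MonCl U i :=
  ⟨h.mono, hU h.nonempty_cokernel_iso.some.symm hZ⟩

lemma epiCl_of_isSES (hV : ∀ {X Y : A}, (X ≅ Y) → V X → V Y) {X Y Z : A} {i : X ⟶ Y}
    {p : Y ⟶ Z} (h : IsSES i p) (hX : V X) : EpiCl V p :=
  ⟨h.epi, hV h.nonempty_kernel_iso.some.symm hX⟩

lemma MonCl.of_isSES (hU : ∀ {X Y : A}, (X ≅ Y) → U X → U Y) {X Y Z : A} {i : X ⟶ Y}
    {p : Y ⟶ Z} (hi : MonCl U i) (h : IsSES i p) : U Z :=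
  hU h.nonempty_cokernel_iso.some hi.2

lemma EpiCl.of_isSES (hV : ∀ {X Y : A}, (X ≅ Y) → V X → V Y) {X Y Z : A} {i : X ⟶ Y}
    {p : Y ⟶ Z} (hp : EpiCl V p) (h : IsSES i p) : V X :=
  hV h.nonempty_kernel_iso.some hp.2

lemma MonCl.isSES {X Y : A} {f : X ⟶ Y} (hf : MonCl U f) : IsSES f (cokernel.π f) :=
  have := hf.1
  IsSES.cokernel f

lemma EpiCl.isSES {X Y : A} {f : X ⟶ Y} (hf : EpiCl V f) : IsSES (kernel.ι f) f :=
  have := hf.1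
  IsSES.kernel f

/-- A mono lifts against an epi as soon as every extension of the cokernel of the former by the
kernel of the latter splits. -/
lemma hasLift_of_splits {X Y Q K Z W : A} {l : X ⟶ Y} {c : Y ⟶ Q} {v : K ⟶ Z} {r : Z ⟶ W}
    (hl : IsSES l c) (hr : IsSES v r)
    (hs : ∀ {E : A} (i : K ⟶ E) (p : E ⟶ Q), IsSES i p → ∃ s : E ⟶ K, i ≫ s = 𝟙 K) :
    HasLift l r := by
  intro f g sq
  have hP := hr.pullback g
  have := hl.mono
  have := hl.epi
  have := hP.mono
  have := hP.epi
  set k : K ⟶ pullback r g := pullback.lift v 0 (by simp [hr.zero])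
  set π := pullback.snd r g
  set a : X ⟶ pullback r g := pullback.lift f l sq.symm
  have haπ : a ≫ π = l := pullback.lift_snd _ _ _
  have : Mono a := mono_of_mono_fac haπ
  have hA := IsSES.cokernel a
  set q := cokernel.π a
  obtain ⟨π', hπ'⟩ := hA.exists_desc (π ≫ c) (by rw [reassoc_of% haπ, hl.zero])
  have : Epi π' := epi_of_epi_fac hπ'
  have : Mono (k ≫ q) := by
    refine Preadditive.mono_of_cancel_zero _ fun x hx => ?_
    obtain ⟨y, hy⟩ := hA.exists_lift (x ≫ k) (by rw [Category.assoc, hx])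
    have hy0 : y = 0 := by
      rw [← cancel_mono l, ← haπ, reassoc_of% hy, hP.zero, comp_zero, zero_comp]
    rw [← cancel_mono k, ← hy, hy0, zero_comp, zero_comp]
  obtain ⟨s, hs⟩ := hs (k ≫ q) π' (IsSES.of_exists_desc
    (by rw [Category.assoc, hπ', reassoc_of% hP.zero, zero_comp]) fun t ht => by
      obtain ⟨w, hw⟩ := hP.exists_desc (q ≫ t) (by rw [← Category.assoc, ht])
      obtain ⟨z, hz⟩ := hl.exists_desc w (by
        rw [← haπ, Category.assoc, hw, reassoc_of% hA.zero, zero_comp])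
      exact ⟨z, by rw [← cancel_epi q, reassoc_of% hπ', hz, hw]⟩)
  rw [Category.assoc] at hs
  obtain ⟨σ, hσ⟩ := hP.exists_desc (𝟙 _ - q ≫ s ≫ k) (by
    rw [Preadditive.comp_sub, Category.comp_id, reassoc_of% hs, sub_self])
  have hlσ : l ≫ σ = a := by
    rw [← haπ, Category.assoc, hσ, Preadditive.comp_sub, reassoc_of% hA.zero, zero_comp,
      Category.comp_id, sub_zero]
  have hσπ : σ ≫ π = 𝟙 Y := by
    rw [← cancel_epi π, reassoc_of% hσ, Preadditive.sub_comp, Category.assoc, Category.assoc,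
      hP.zero, comp_zero, comp_zero, Category.id_comp, Category.comp_id, sub_zero]
  refine ⟨σ ≫ pullback.fst r g, ?_, ?_⟩
  · rw [reassoc_of% hlσ]
    exact pullback.lift_fst _ _ _
  · rw [Category.assoc, pullback.condition, reassoc_of% hσπ]

namespace IsCompleteCotorsionPair

lemma hasLift (h : IsCompleteCotorsionPair U V) {X Y Z W : A} {l : X ⟶ Y} {r : Z ⟶ W}
    (hl : MonCl U l) (hr : EpiCl V r) : HasLift l r :=
  hasLift_of_splits hl.isSES hr.isSES fun i p hip => h.ext_zero i p hr.2 hl.2 hip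

lemma monCl_of_hasLift (h : IsCompleteCotorsionPair U V) {X Y : A} (f : X ⟶ Y)
    (hf : ∀ {Z W : A} (r : Z ⟶ W), EpiCl V r → HasLift f r) : MonCl U f := by
  obtain ⟨VX, _, j, _, _, hVX, hj⟩ := h.complete_right X
  obtain ⟨t, ht, _⟩ := hf _ (epiCl_of_isSES h.isoV (IsSES.id_zero VX) hVX) j 0 (by simp)
  have := hj.mono
  have : Mono f := mono_of_mono_fac ht
  obtain ⟨_, U', i, p, hU', hV', hip⟩ := h.complete_left (cokernel f)
  obtain ⟨t, ht, htp⟩ := hf _ (epiCl_of_isSES h.isoV hip hV') 0 (cokernel.π f) (by simp)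
  exact ⟨inferInstance, h.summandU (cokernel.desc f t ht) p
    (by rw [← cancel_epi (cokernel.π f)]; simp [htp]) hU'⟩

lemma epiCl_of_hasLift (h : IsCompleteCotorsionPair U V) {X Y : A} (g : X ⟶ Y)
    (hg : ∀ {Z W : A} (l : Z ⟶ W), MonCl U l → HasLift l g) : EpiCl V g := by
  obtain ⟨_, UY, _, j, hUY, _, hj⟩ := h.complete_left Y
  obtain ⟨t, _, ht⟩ := hg _ (monCl_of_isSES h.isoU (IsSES.zero_id UY) hUY) 0 j (by simp)
  have := hj.epi
  have : Epi g := epi_of_epi_fac ht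
  obtain ⟨V', _, i, p, hU', hV', hip⟩ := h.complete_right (kernel g)
  obtain ⟨t, hit, htg⟩ := hg _ (monCl_of_isSES h.isoU hip hU') (kernel.ι g) 0 (by simp)
  exact ⟨inferInstance, h.summandV i (kernel.lift g t htg)
    (by rw [← cancel_mono (kernel.ι g)]; simp [hit]) hV'⟩

lemma exists_factorization (h : IsCompleteCotorsionPair U V) {X Y : A} (f : X ⟶ Y) :
    ∃ (Z : A) (l : X ⟶ Z) (r : Z ⟶ Y), MonCl U l ∧ EpiCl V r ∧ l ≫ r = f := by
  obtain ⟨_, UY, _, p, hUY, _, hp⟩ := h.complete_left Y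
  have := hp.epi
  have fac : biprod.inr ≫ biprod.desc f p = p := biprod.inr_desc _ _
  have : Epi (biprod.desc f p) := epi_of_epi_fac fac
  have hK := IsSES.kernel (biprod.desc f p)
  obtain ⟨VK, _, j, _, hUK, hVK, hj⟩ := h.complete_right (kernel (biprod.desc f p))
  refine ⟨pushout (kernel.ι (biprod.desc f p)) j, biprod.inl ≫ pushout.inl _ _,
    pushout.desc (biprod.desc f p) 0 (by simp), ?_,
    epiCl_of_isSES h.isoV (hK.pushout j) hVK, by simp [pushout.inl_desc]⟩
  refine h.monCl_of_hasLift _ fun r hr x y sq => ?_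
  rw [Category.assoc] at sq
  obtain ⟨t, ht, htr⟩ := h.hasLift (monCl_of_isSES h.isoU (IsSES.inl_snd X UY) hUY) hr _ _ sq
  obtain ⟨s, hs, hsr⟩ := h.hasLift (monCl_of_isSES h.isoU hj hUK) hr
    (kernel.ι (biprod.desc f p) ≫ t) (pushout.inr _ _ ≫ y) (by
      rw [Category.assoc, htr, pushout.condition_assoc])
  refine ⟨pushout.desc t s hs.symm, by simp [ht, pushout.inl_desc], ?_⟩
  ext1 <;> simp [htr, hsr, pushout.inl_desc_assoc, pushout.inr_desc_assoc]

lemma isWFS (h : IsCompleteCotorsionPair U V) : IsWFS (MonCl U) (EpiCl V) :=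
  ⟨fun f => ⟨fun hf _ _ _ hr => h.hasLift hf hr, h.monCl_of_hasLift f⟩,
    fun g => ⟨fun hg _ _ _ hl => h.hasLift hl hg, h.epiCl_of_hasLift g⟩,
    h.exists_factorization⟩

/-- If `U` is closed under kernels of epis, then `V` is closed under cokernels of monos. -/
lemma right_closed_of_left_closed (h : IsCompleteCotorsionPair U V)
    (hU : ∀ {X Y Z : A} (i : X ⟶ Y) (p : Y ⟶ Z), IsSES i p → U Y → U Z → U X)
    {V₁ V₂ W : A} (i : V₁ ⟶ V₂) (p : V₂ ⟶ W) (hip : IsSES i p) (h₁ : V V₁) (h₂ : V V₂) :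
    V W := by
  obtain ⟨VW, U', w, q, hU', hVW, hE⟩ := h.complete_right W
  obtain ⟨_, UE, a, α, hUE, _, ha⟩ := h.complete_left VW
  have := ha.epi
  have := hE.epi
  have hK := IsSES.kernel (α ≫ q)
  have hUK := hU _ _ hK hUE hU'
  obtain ⟨u, v, huv, hu, hv⟩ := IsSES.exists_kernel_comp ha hE hK
  obtain ⟨t, _, htp⟩ := h.hasLift (monCl_of_isSES h.isoU (IsSES.zero_id _) hUK)
    (epiCl_of_isSES h.isoV hip h₁) 0 v (by simp)
  obtain ⟨s, hs, _⟩ := h.hasLift (monCl_of_isSES h.isoU hK hU')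
    (epiCl_of_isSES h.isoV (IsSES.id_zero V₂) h₂) t 0 (by simp)
  obtain ⟨ρ, hρ⟩ := ha.exists_desc (s ≫ p) (by
    rw [← hu, Category.assoc, reassoc_of% hs, htp, huv.zero])
  have := huv.epi
  refine h.summandV w ρ ?_ hVW
  rw [← cancel_epi v, reassoc_of% hv, hρ, reassoc_of% hs, htp, Category.comp_id]

/-- If `V` is closed under cokernels of monos, then `U` is closed under kernels of epis. -/
lemma left_closed_of_right_closed (h : IsCompleteCotorsionPair U V)
    (hV : ∀ {X Y Z : A} (i : X ⟶ Y) (p : Y ⟶ Z), IsSES i p → V X → V Y → V Z)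
    {W U₂ U₁ : A} (i : W ⟶ U₂) (p : U₂ ⟶ U₁) (hip : IsSES i p) (h₂ : U U₂) (h₁ : U U₁) :
    U W := by
  obtain ⟨V', UW, q, w, hUW, hV', hE⟩ := h.complete_left W
  obtain ⟨VE, _, α, a, _, hVE, ha⟩ := h.complete_right UW
  have := ha.mono
  have := hE.mono
  have hC := IsSES.cokernel (q ≫ α)
  have hVC := hV _ _ hC hV' hVE
  obtain ⟨u, v, huv, hu, hv⟩ := IsSES.exists_cokernel_comp hE ha hC
  obtain ⟨t, hit, _⟩ := h.hasLift (monCl_of_isSES h.isoU hip h₁)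
    (epiCl_of_isSES h.isoV (IsSES.id_zero _) hVC) u 0 (by simp)
  obtain ⟨s, _, hs⟩ := h.hasLift (monCl_of_isSES h.isoU (IsSES.zero_id U₂) h₂)
    (epiCl_of_isSES h.isoV hC hV') 0 t (by simp)
  obtain ⟨ρ, hρ⟩ := ha.exists_lift (i ≫ s) (by
    rw [← hv, Category.assoc, reassoc_of% hs, reassoc_of% hit, huv.zero])
  have := huv.mono
  refine h.summandU ρ w ?_ hUW
  rw [← cancel_mono u, Category.assoc, hu, reassoc_of% hρ, hs, hit, Category.id_comp]

end IsCompleteCotorsionPair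

lemma IsWFS.isCompleteCotorsionPair (hU : ∀ {X Y : A}, (X ≅ Y) → U X → U Y)
    (hV : ∀ {X Y : A}, (X ≅ Y) → V X → V Y)
    (hUs : ∀ {X Z : A} (i : X ⟶ Z) (r : Z ⟶ X), i ≫ r = 𝟙 X → U Z → U X)
    (hVs : ∀ {X Z : A} (i : X ⟶ Z) (r : Z ⟶ X), i ≫ r = 𝟙 X → V Z → V X)
    (h : IsWFS (MonCl U) (EpiCl V)) : IsCompleteCotorsionPair U V where
  isoU := hU
  isoV := hV
  summandU := hUs
  summandV := hVs
  ext_zero {V' _ _} i p hV' hU' hip := by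
    obtain ⟨t, ht, _⟩ := (h.1 i).1 (monCl_of_isSES hU hip hU') _
      (epiCl_of_isSES hV (IsSES.id_zero V') hV') (𝟙 _) 0 (by simp)
    exact ⟨t, ht⟩
  complete_left C := by
    obtain ⟨Z, f, g, hf, hg, _⟩ := h.2.2 (0 : (0 : A) ⟶ C)
    obtain rfl : f = 0 := (isZero_zero A).eq_of_src _ _
    exact ⟨_, Z, _, g, hf.of_isSES hU (IsSES.zero_id Z), hg.2, hg.isSES⟩
  complete_right C := by
    obtain ⟨Z, f, g, hf, hg, _⟩ := h.2.2 (0 : C ⟶ (0 : A))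
    obtain rfl : g = 0 := (isZero_zero A).eq_of_tgt _ _
    exact ⟨Z, _, f, _, hf.2, hg.of_isSES hV (IsSES.id_zero Z), hf.isSES⟩

lemma leftCancel_monCl_iff (hU : ∀ {X Y : A}, (X ≅ Y) → U X → U Y) :
    LeftCancel (MonCl U) ↔
      ∀ {X Y Z : A} (i : X ⟶ Y) (p : Y ⟶ Z), IsSES i p → U Y → U Z → U X := by
  refine ⟨fun h X Y Z i p hip hY hZ => ?_, fun h X Y Z α β hαβ hβ => ?_⟩
  · refine (h (0 : (0 : A) ⟶ X) i ?_ (monCl_of_isSES hU hip hZ)).of_isSES hU (IsSES.zero_id X)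
    rw [zero_comp]
    exact monCl_of_isSES hU (IsSES.zero_id Y) hY
  · have := hαβ.1
    have : Mono α := mono_of_mono α β
    obtain ⟨u, v, huv, -⟩ := IsSES.exists_cokernel_comp (IsSES.cokernel α) hβ.isSES hαβ.isSES
    exact ⟨inferInstance, h u v huv hαβ.2 hβ.2⟩

lemma rightCancel_epiCl_iff (hV : ∀ {X Y : A}, (X ≅ Y) → V X → V Y) :
    RightCancel (EpiCl V) ↔
      ∀ {X Y Z : A} (i : X ⟶ Y) (p : Y ⟶ Z), IsSES i p → V X → V Y → V Z := by
  refine ⟨fun h X Y Z i p hip hX hY => ?_, fun h X Y Z α β hαβ hα => ?_⟩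
  · refine (h p (0 : Z ⟶ (0 : A)) ?_ (epiCl_of_isSES hV hip hX)).of_isSES hV (IsSES.id_zero Z)
    rw [comp_zero]
    exact epiCl_of_isSES hV (IsSES.id_zero Y) hY
  · have := hαβ.1
    have : Epi β := epi_of_epi α β
    obtain ⟨u, v, huv, -⟩ := IsSES.exists_kernel_comp hα.isSES (IsSES.kernel β) hαβ.isSES
    exact ⟨inferInstance, h u v huv hα.2 hαβ.2⟩

end

/-- For classes `U`, `V` closed under isomorphisms and direct summands, the following are
equivalent: (1) `(U, V)` is a complete hereditary cotorsion pair; (2) `(Mon(U), Epi(V))`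
is a weak factorization system with `Mon(U)` satisfying left cancellation;
(3) `(Mon(U), Epi(V))` is a weak factorization system with `Epi(V)` satisfying right
cancellation. -/
theorem stmt10 (U V : A → Prop)
    (hU : ∀ {X Y : A}, (X ≅ Y) → U X → U Y)
    (hV : ∀ {X Y : A}, (X ≅ Y) → V X → V Y)
    (hUs : ∀ {X Z : A} (i : X ⟶ Z) (r : Z ⟶ X), i ≫ r = 𝟙 X → U Z → U X)
    (hVs : ∀ {X Z : A} (i : X ⟶ Z) (r : Z ⟶ X), i ≫ r = 𝟙 X → V Z → V X) :
    ((IsCompleteCotorsionPair U V ∧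
        (∀ {X Y Z : A} (i : X ⟶ Y) (p : Y ⟶ Z), IsSES i p → U Y → U Z → U X)) ↔
      (IsWFS (MonCl U) (EpiCl V) ∧ LeftCancel (MonCl U))) ∧
    ((IsCompleteCotorsionPair U V ∧
        (∀ {X Y Z : A} (i : X ⟶ Y) (p : Y ⟶ Z), IsSES i p → U Y → U Z → U X)) ↔
      (IsWFS (MonCl U) (EpiCl V) ∧ RightCancel (EpiCl V))) := by
  have hWFS : IsCompleteCotorsionPair U V ↔ IsWFS (MonCl U) (EpiCl V) :=
    ⟨fun h => h.isWFS, IsWFS.isCompleteCotorsionPair hU hV hUs hVs⟩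
  rw [← hWFS, leftCancel_monCl_iff hU, rightCancel_epiCl_iff hV]
  exact ⟨Iff.rfl, and_congr_right fun h =>
    ⟨fun hU' _ _ _ i p => h.right_closed_of_left_closed hU' i p,
      fun hV' _ _ _ i p => h.left_closed_of_right_closed hV' i p⟩⟩
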